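/- Let Γ = Sp(2g, ℤ) with g ≥ 3, and suppose Γ acts on a set M such that: (a) some non-central element u of order 3 lies in the kernel U of the action; (b) U contains the congruence subgroup C(k) = ker(Sp(2g,ℤ) → Sp(2g,ℤ/kℤ)) for some k ≥ 1; (c) Γ is perfect; (d) for every prime power p^r dividing k, the kernel of Sp(2g,ℤ/p^rℤ) → PSp(2g,ℤ/pℤ) is solvable and PSp(2g,ℤ/pℤ) is simple non-abelian; (e) the image of u in PSp(2g,ℤ/pℤ) is nontrivial for each prime p dividing k. Then the action of Γ on M is trivial. -/

import Mathlib

open Matrix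

theorem Group.isSolvable_pi {ι : Type*} [Finite ι] {H : ι → Type*} [∀ i, Group (H i)]
    [∀ i, Group.IsSolvable (H i)] : Group.IsSolvable (∀ i, H i) := by
  have := Fintype.ofFinite ι
  choose n hn using fun i => Group.IsSolvable.solvable (G := H i)
  refine ⟨⟨Finset.univ.sup n, (Subgroup.eq_bot_iff_forall _).2 fun x hx => funext fun i => ?_⟩⟩
  have h₁ : x i ∈ derivedSeries (H i) (Finset.univ.sup n) :=
    map_derivedSeries_le_derivedSeries (Pi.evalMonoidHom H i) _ ⟨x, hx, rfl⟩
  have h₂ := derivedSeries_antitone (H i) (Finset.le_sup (f := n) (Finset.mem_univ i)) h₁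
  rwa [hn, Subgroup.mem_bot] at h₂

section Perfect

variable {G : Type*} [Group G] [Group.IsPerfect G] (N : Subgroup G) [N.Normal]

theorem Group.IsPerfect.sup_inf_eq_top (A B : Subgroup G) [A.Normal] [B.Normal]
    (hA : N ⊔ A = ⊤) (hB : N ⊔ B = ⊤) : N ⊔ A ⊓ B = ⊤ := by
  have h : ∀ C : Subgroup G, N ⊔ C = ⊤ → C.map (QuotientGroup.mk' N) = ⊤ := fun C hC => by
    have := congrArg (Subgroup.map (QuotientGroup.mk' N)) hC
    rwa [Subgroup.map_sup, QuotientGroup.map_mk'_self, bot_sup_eq,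
      Subgroup.map_top_of_surjective _ (QuotientGroup.mk'_surjective N)] at this
  have key : (⁅A, B⁆ : Subgroup G).map (QuotientGroup.mk' N) = ⊤ := by
    rw [Subgroup.map_commutator, h A hA, h B hB]
    exact Group.IsPerfect.commutator_eq_top
  have : ((A ⊓ B).map (QuotientGroup.mk' N)) = ⊤ :=
    top_le_iff.1 (key ▸ Subgroup.map_mono (Subgroup.commutator_le_inf A B))
  have := congrArg (Subgroup.comap (QuotientGroup.mk' N)) this
  rwa [Subgroup.comap_map_eq, QuotientGroup.ker_mk', Subgroup.comap_top, sup_comm] at this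

theorem Group.IsPerfect.sup_iInf_eq_top {ι : Type*} [Finite ι] (K : ι → Subgroup G)
    [∀ i, (K i).Normal] (hK : ∀ i, N ⊔ K i = ⊤) : N ⊔ ⨅ i, K i = ⊤ := by
  classical
  have := Fintype.ofFinite ι
  suffices h : ∀ s : Finset ι, (⨅ i ∈ s, K i).Normal ∧ N ⊔ ⨅ i ∈ s, K i = ⊤ by
    simpa using (h Finset.univ).2
  intro s
  induction s using Finset.induction_on with
  | empty =>
    simp only [Finset.notMem_empty, iInf_false, iInf_top, sup_top_eq, and_true]
    infer_instance
  | insert i s _ ih =>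
    have := ih.1
    rw [Finset.iInf_insert]
    exact ⟨inferInstance, sup_inf_eq_top N _ _ (hK i) ih.2⟩

theorem Group.IsPerfect.eq_top_of_sup_comap_eq_top {ι : Type*} [Finite ι] {H : ι → Type*}
    [∀ i, Group (H i)] (f : ∀ i, G →* H i) (S : ∀ i, Subgroup (H i)) [∀ i, (S i).Normal]
    [∀ i, Group.IsSolvable (S i)] (hN : ⨅ i, (f i).ker ≤ N)
    (h : ∀ i, N ⊔ (S i).comap (f i) = ⊤) : N = ⊤ := by
  set I : Subgroup G := ⨅ i, (S i).comap (f i) with hI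
  have hNI : N ⊔ I = ⊤ := sup_iInf_eq_top N _ h
  let ψ : I →* ∀ i, S i := MonoidHom.pi fun i =>
    ((f i).comp I.subtype).codRestrict (S i) fun x => (Subgroup.mem_iInf.1 x.2 i :)
  let φ : I →* G ⧸ N := (QuotientGroup.mk' N).comp I.subtype
  have hφ : Function.Surjective φ := by
    rw [← MonoidHom.range_eq_top, MonoidHom.range_comp, Subgroup.range_subtype]
    have := congrArg (Subgroup.map (QuotientGroup.mk' N)) hNI
    rwa [Subgroup.map_sup, QuotientGroup.map_mk'_self, bot_sup_eq,
      Subgroup.map_top_of_surjective _ (QuotientGroup.mk'_surjective N)] at this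
  have hker : ψ.ker ≤ φ.ker := fun x hx => by
    refine (QuotientGroup.eq_one_iff _).2 (hN (Subgroup.mem_iInf.2 fun i => ?_))
    exact congrArg Subtype.val (congrFun hx i)
  have := Group.isSolvable_pi (H := fun i => S i)
  obtain ⟨n, hn⟩ := Group.IsSolvable.solvable (G := ∀ i, S i)
  have h₁ : derivedSeries I n ≤ ψ.ker := by
    rw [← (derivedSeries I n).map_eq_bot_iff, ← le_bot_iff, ← hn]
    exact map_derivedSeries_le_derivedSeries ψ n
  have h₂ := map_derivedSeries_eq hφ n
  rw [(Subgroup.map_eq_bot_iff _).2 (h₁.trans hker), Group.IsPerfect.derivedSeries_eq_top] at h₂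
  refine top_le_iff.1 fun x _ => (QuotientGroup.eq_one_iff x).1 ?_
  rw [← Subgroup.mem_bot, h₂]
  trivial

end Perfect

namespace SymplecticGroup

variable {l R K : Type*} [DecidableEq l] [Fintype l]

section CommRing

variable [CommRing R]

theorem upper_mem {S : Matrix l l R} (hS : S.IsSymm) :
    fromBlocks 1 S 0 1 ∈ symplecticGroup l R := by
  simp [fromBlocks_mem_iff, hS.eq]

theorem lower_mem {S : Matrix l l R} (hS : S.IsSymm) :
    fromBlocks 1 0 S 1 ∈ symplecticGroup l R := by
  simp [fromBlocks_mem_iff, hS.eq]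

theorem fromBlocks_diag_mem {P Q : Matrix l l R} (h : P * Q = 1) :
    fromBlocks P 0 0 Qᵀ ∈ symplecticGroup l R := by
  simp [fromBlocks_mem_iff, ← transpose_mul, mul_eq_one_comm.1 h]

/-- Entrywise application of a ring homomorphism, as a homomorphism of symplectic groups. -/
def mapHom {S : Type*} [CommRing S] (f : R →+* S) : symplecticGroup l R →* symplecticGroup l S where
  toFun A := ⟨(A : Matrix (l ⊕ l) (l ⊕ l) R).map f, map_mem A.2 f⟩
  map_one' := Subtype.ext (f.mapMatrix (m := l ⊕ l)).map_one
  map_mul' A B := Subtype.ext ((f.mapMatrix (m := l ⊕ l)).map_mul A B)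

@[simp]
theorem coe_mapHom {S : Type*} [CommRing S] (f : R →+* S) (A : symplecticGroup l R) :
    (mapHom f A : Matrix (l ⊕ l) (l ⊕ l) S) = (A : Matrix (l ⊕ l) (l ⊕ l) R).map f := rfl

end CommRing

section Field

variable [Field K]

theorem isUnit_det_diagonal_add_mul [DecidableEq K] {C : Matrix l l K} {d : l → K}
    (hsymm : diagonal d * C = Cᵀ * diagonal d)
    (hker : ∀ x, diagonal d *ᵥ x = 0 → C *ᵥ x = 0 → x = 0) :
    IsUnit (diagonal d + diagonal (fun i => if d i = 0 then 1 else 0) * C).det := by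
  rw [← isUnit_iff_isUnit_det, ← mulVec_injective_iff_isUnit, ← coe_mulVecLin,
    ← LinearMap.ker_eq_bot, ker_mulVecLin_eq_bot_iff]
  intro x hx
  have hrow : ∀ i, d i * x i + (if d i = 0 then 1 else 0) * (C *ᵥ x) i = 0 := fun i => by
    simpa [add_mulVec, ← mulVec_mulVec, mulVec_diagonal] using congrFun hx i
  have hdx : diagonal d *ᵥ x = 0 := funext fun i => by
    rw [mulVec_diagonal, Pi.zero_apply]
    by_cases hi : d i = 0
    · rw [hi, zero_mul]
    · simpa [hi] using hrow i
  refine hker x hdx (funext fun i => ?_)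
  by_cases hi : d i = 0
  · simpa [hi] using hrow i
  · have h : diagonal d *ᵥ (C *ᵥ x) = 0 := by
      rw [mulVec_mulVec, hsymm, ← mulVec_mulVec, hdx, mulVec_zero]
    simpa [mulVec_diagonal, hi] using congrFun h i

theorem exists_isSymm_isUnit_det_add_mul {A C : Matrix l l K} (hsymm : Aᵀ * C = Cᵀ * A)
    (hker : ∀ x, A *ᵥ x = 0 → C *ᵥ x = 0 → x = 0) :
    ∃ S : Matrix l l K, S.IsSymm ∧ IsUnit (A + S * C).det := by
  classical
  obtain ⟨L, L', d, hA⟩ := Pivot.exists_list_transvec_mul_diagonal_mul_list_transvec A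
  set V := (L.map TransvectionStruct.toMatrix).prod with hV
  set W := (L'.map TransvectionStruct.toMatrix).prod with hW
  have hVdet : IsUnit V.det := by simp [hV]
  have hWdet : IsUnit W.det := by simp [hW]
  have hWW := mul_nonsing_inv W hWdet
  have hWW' := nonsing_inv_mul W hWdet
  set C' := Vᵀ * C * W⁻¹ with hC'
  have hCW : C' * W = Vᵀ * C := by rw [hC', mul_assoc, hWW', mul_one]
  have hdC : diagonal d * C' = C'ᵀ * diagonal d := by
    have h : (W⁻¹)ᵀ * (Aᵀ * C) * W⁻¹ = (W⁻¹)ᵀ * (Cᵀ * A) * W⁻¹ := by rw [hsymm]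
    have hWT : (W⁻¹)ᵀ * Wᵀ = 1 := by rw [← transpose_mul, hWW, transpose_one]
    calc diagonal d * C' = ((W⁻¹)ᵀ * Wᵀ) * diagonal d * Vᵀ * C * W⁻¹ := by
          rw [hWT, hC']; simp only [one_mul, mul_assoc]
      _ = (W⁻¹)ᵀ * (Aᵀ * C) * W⁻¹ := by
          rw [hA]; simp only [transpose_mul, diagonal_transpose, mul_assoc]
      _ = (W⁻¹)ᵀ * (Cᵀ * A) * W⁻¹ := h
      _ = C'ᵀ * diagonal d * (W * W⁻¹) := by
          rw [hA, hC']; simp only [transpose_mul, transpose_transpose, mul_assoc]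
      _ = C'ᵀ * diagonal d := by rw [hWW, mul_one]
  have hdker : ∀ x, diagonal d *ᵥ x = 0 → C' *ᵥ x = 0 → x = 0 := fun x h₁ h₂ => by
    have hVT : IsUnit Vᵀ := by rwa [isUnit_iff_isUnit_det, det_transpose]
    have hx : W⁻¹ *ᵥ x = 0 := by
      refine hker _ ?_ (mulVec_injective_iff_isUnit.2 hVT ?_)
      · rw [hA, mulVec_mulVec, mul_assoc, hWW, mul_one, ← mulVec_mulVec, h₁, mulVec_zero]
      · rw [mulVec_zero, mulVec_mulVec, mulVec_mulVec, h₂]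
    rw [← one_mulVec x, ← hWW, ← mulVec_mulVec, hx, mulVec_zero]
  set E : Matrix l l K := diagonal fun i => if d i = 0 then 1 else 0
  refine ⟨V * E * Vᵀ, ?_, ?_⟩
  · simp [IsSymm, E, mul_assoc]
  · have h : A + V * E * Vᵀ * C = V * (diagonal d + E * C') * W := by
      rw [mul_add, add_mul, ← hA, mul_assoc V (E * C'), mul_assoc E, hCW]
      simp only [mul_assoc]
    rw [h, det_mul, det_mul]
    exact (hVdet.mul (isUnit_det_diagonal_add_mul hdC hdker)).mul hWdet

end Field

section Image

variable [CommRing R] [Field K]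

variable (l) in
/-- The matrices that lift along `f` to symplectic matrices. -/
def liftable (f : R →+* K) : Submonoid (Matrix (l ⊕ l) (l ⊕ l) K) :=
  (symplecticGroup l R).map (f.mapMatrix (m := l ⊕ l)).toMonoidHom

variable {f : R →+* K}

theorem mem_liftable_of_mul_mem {X Y : Matrix (l ⊕ l) (l ⊕ l) K} (hX : X ∈ liftable l f)
    (hXY : X * Y ∈ liftable l f) : Y ∈ liftable l f := by
  obtain ⟨A, hA, rfl⟩ := hX
  let a : symplecticGroup l R := ⟨A, hA⟩
  have h : f.mapMatrix (a⁻¹ : symplecticGroup l R).1 * f.mapMatrix A = 1 := by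
    rw [← map_mul]
    exact (congrArg (fun B : symplecticGroup l R => f.mapMatrix B.1) (inv_mul_cancel a)).trans
      (map_one _)
  have ha : f.mapMatrix (a⁻¹ : symplecticGroup l R).1 ∈ liftable l f := ⟨_, (a⁻¹).2, rfl⟩
  have := mul_mem ha hXY
  rw [← mul_assoc] at this
  exact (congrArg (· * Y) h).trans (one_mul Y) ▸ this

variable (hf : Function.Surjective f)
include hf

omit [DecidableEq l] [Fintype l] in
theorem exists_isSymm_map_eq {S : Matrix l l K} (hS : S.IsSymm) :
    ∃ T : Matrix l l R, T.IsSymm ∧ T.map f = S := by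
  choose s hs using hf
  exact ⟨S.map s, hS.map s, Matrix.ext fun i j => hs (S i j)⟩

theorem upper_mem_liftable {S : Matrix l l K} (hS : S.IsSymm) :
    fromBlocks 1 S 0 1 ∈ liftable l f := by
  obtain ⟨T, hT, rfl⟩ := exists_isSymm_map_eq hf hS
  exact ⟨_, upper_mem hT, by simp [fromBlocks_map]⟩

theorem lower_mem_liftable {S : Matrix l l K} (hS : S.IsSymm) :
    fromBlocks 1 0 S 1 ∈ liftable l f := by
  obtain ⟨T, hT, rfl⟩ := exists_isSymm_map_eq hf hS
  exact ⟨_, lower_mem hT, by simp [fromBlocks_map]⟩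

theorem diagonal_mem_liftable {d : l → K} (hd : ∀ i, d i ≠ 0) :
    fromBlocks (diagonal d) 0 0 (diagonal d⁻¹) ∈ liftable l f := by
  have hU := upper_mem_liftable hf (isSymm_diagonal d)
  have hL := lower_mem_liftable hf (isSymm_diagonal (-d⁻¹))
  have hJ : J l K ∈ liftable l f := ⟨J l R, J_mem l R, by simp⟩
  have h₁ : diagonal d * diagonal d⁻¹ = 1 := by
    rw [diagonal_mul_diagonal, ← diagonal_one]
    exact congrArg _ (funext fun i => mul_inv_cancel₀ (hd i))
  convert mul_mem (mul_mem (mul_mem hU hL) hU) hJ using 1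
  have h₂ : diagonal (-d⁻¹) = -diagonal d⁻¹ := (diagonal_neg _).symm
  simp only [J, fromBlocks_multiply, h₂, h₁, mul_eq_one_comm.1 h₁, neg_mul, mul_neg, mul_one,
    one_mul, mul_zero, add_zero, zero_add]
  simp

theorem levi_mem_liftable {P Q : Matrix l l K} (hPQ : P * Q = 1) :
    fromBlocks P 0 0 Qᵀ ∈ liftable l f := by
  obtain rfl : P⁻¹ = Q := inv_eq_right_inv hPQ
  have hdet : P.det ≠ 0 := fun h => by simpa [h] using congrArg det hPQ
  clear hPQ
  refine diagonal_transvection_induction_of_det_ne_zero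
    (fun P => fromBlocks P 0 0 (P⁻¹)ᵀ ∈ liftable l f) P hdet ?_ ?_ ?_
  · intro d hd
    have hd' : ∀ i, d i ≠ 0 := fun i =>
      (Finset.prod_ne_zero_iff.1 (by rwa [det_diagonal] at hd)) i (Finset.mem_univ i)
    have h : (diagonal d)⁻¹ = diagonal d⁻¹ := inv_eq_right_inv (by
      rw [diagonal_mul_diagonal, ← diagonal_one]
      exact congrArg _ (funext fun i => mul_inv_cancel₀ (hd' i)))
    rw [h, diagonal_transpose]
    exact diagonal_mem_liftable hf hd'
  · intro t
    obtain ⟨c, hc⟩ := hf t.c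
    let T : TransvectionStruct l R := ⟨t.i, t.j, t.hij, c⟩
    refine ⟨_, fromBlocks_diag_mem T.mul_inv, ?_⟩
    have h : (t.toMatrix)⁻¹ = t.inv.toMatrix := inv_eq_right_inv t.mul_inv
    have h₁ : T.toMatrix.map f = t.toMatrix := by
      simp [T, TransvectionStruct.toMatrix, transvection, Matrix.map_add, hc]
    have h₂ : T.inv.toMatrix.map f = t.inv.toMatrix := by
      simp [T, TransvectionStruct.toMatrix, TransvectionStruct.inv, transvection, Matrix.map_add,
        hc]
    rw [h, ← h₁, ← h₂]
    simp [fromBlocks_map, transpose_map]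
  · intro P Q hP hQ ihP ihQ
    convert mul_mem ihP ihQ using 1
    simp [fromBlocks_multiply, Matrix.mul_inv_rev, transpose_mul]

theorem mem_liftable_of_isUnit_det {A B C D : Matrix l l K}
    (h : fromBlocks A B C D ∈ symplecticGroup l K) (hA : IsUnit A.det) :
    fromBlocks A B C D ∈ liftable l f := by
  have hAA := mul_nonsing_inv A hA
  have hAA' := nonsing_inv_mul A hA
  refine mem_liftable_of_mul_mem (levi_mem_liftable hf hAA') ?_
  have hC : (C * A⁻¹).IsSymm := by
    have h₁ := (fromBlocks_mem_iff.1 h).1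
    have : (A⁻¹)ᵀ * (Aᵀ * C) * A⁻¹ = (A⁻¹)ᵀ * (Cᵀ * A) * A⁻¹ := by rw [h₁]
    rw [← mul_assoc, ← transpose_mul, hAA, transpose_one, one_mul, mul_assoc, mul_assoc, hAA,
      mul_one, ← transpose_mul] at this
    exact this.symm
  have hmem := mul_mem (fromBlocks_diag_mem hAA') h
  simp only [fromBlocks_multiply, Matrix.zero_mul, add_zero, zero_add, hAA'] at hmem ⊢
  set B' := A⁻¹ * B
  set C' := Aᵀ * C
  set D' := Aᵀ * D
  obtain ⟨h₁, h₂, h₃⟩ := fromBlocks_mem_iff.1 hmem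
  simp only [transpose_one, one_mul, mul_one] at h₁ h₃
  have hC' : C'.IsSymm := h₁.symm
  refine mem_liftable_of_mul_mem (lower_mem_liftable hf hC'.neg) ?_
  have hD : -C' * B' + D' = 1 := by rw [← h₃, ← h₁, neg_mul]; abel
  have hB' : B'.IsSymm := by
    have : D' = 1 + C' * B' := by rw [← hD]; simp
    rw [this] at h₂
    simpa [mul_add, add_mul, transpose_mul, ← h₁, mul_assoc, IsSymm] using h₂
  have := upper_mem_liftable hf hB'
  simpa only [fromBlocks_multiply, hD, one_mul, zero_mul, mul_one, neg_add_cancel, add_zero]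
    using this

theorem symplecticGroup_le_liftable : symplecticGroup l K ≤ liftable l f := by
  intro M hM
  obtain ⟨A, B, C, D, rfl⟩ : ∃ A B C D, M = fromBlocks A B C D :=
    ⟨_, _, _, _, (fromBlocks_toBlocks M).symm⟩
  have hker : ∀ x, A *ᵥ x = 0 → C *ᵥ x = 0 → x = 0 := fun x h₁ h₂ => by
    have hU := (isUnit_iff_isUnit_det _).2 (symplectic_det hM)
    have h : Sum.elim x 0 = 0 := mulVec_injective_iff_isUnit.2 hU
      (by simp [fromBlocks_mulVec, h₁, h₂])
    exact funext fun i => congrFun h (Sum.inl i)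
  obtain ⟨S, hS, hdet⟩ := exists_isSymm_isUnit_det_add_mul (fromBlocks_mem_iff.1 hM).1 hker
  refine mem_liftable_of_mul_mem (upper_mem_liftable hf hS) ?_
  have hmem := mul_mem (upper_mem hS) hM
  simp only [fromBlocks_multiply, Matrix.one_mul, Matrix.zero_mul, zero_add] at hmem ⊢
  exact mem_liftable_of_isUnit_det hf hmem hdet

theorem mapHom_surjective : Function.Surjective (mapHom (l := l) f) := fun M => by
  obtain ⟨A, hA, h⟩ := symplecticGroup_le_liftable hf M.2
  exact ⟨⟨A, hA⟩, Subtype.ext h⟩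

end Image
end SymplecticGroup

/-- Main theorem (abstracted): let Γ = Sp(2g, ℤ) with g ≥ 3 act on a set M. Suppose
(a) some non-central element u of order 3 acts trivially on M;
(b) the congruence subgroup C(k) = ker(Sp(2g,ℤ) → Sp(2g,ℤ/kℤ)) acts trivially on M;
(c) Γ is perfect;
(d) for every prime power p^r exactly dividing k, the kernel of the (entrywise) map
    Sp(2g,ℤ/p^rℤ) → PSp(2g,ℤ/pℤ) is solvable and PSp(2g,ℤ/pℤ) is simple non-abelian;
(e) the image of u in PSp(2g,ℤ/pℤ) is nontrivial for each prime p dividing k.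
Then the action of Γ on M is trivial. -/
theorem sp_action_trivial
    (g k : ℕ) (hg : 3 ≤ g) (hk : 1 ≤ k)
    {M : Type*} [MulAction (Matrix.symplecticGroup (Fin g) ℤ) M]
    -- (a) a non-central element u of order 3 acting trivially on M
    (u : Matrix.symplecticGroup (Fin g) ℤ)
    (hu3 : orderOf u = 3)
    (hucen : u ∉ Subgroup.center (Matrix.symplecticGroup (Fin g) ℤ))
    (huact : ∀ x : M, u • x = x)
    -- the entrywise reduction map π : Sp(2g,ℤ) → Sp(2g,ℤ/kℤ)
    (π : Matrix.symplecticGroup (Fin g) ℤ →* Matrix.symplecticGroup (Fin g) (ZMod k))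
    (hπ : ∀ A : Matrix.symplecticGroup (Fin g) ℤ,
      (π A : Matrix (Fin g ⊕ Fin g) (Fin g ⊕ Fin g) (ZMod k)) =
        (A : Matrix (Fin g ⊕ Fin g) (Fin g ⊕ Fin g) ℤ).map (Int.castRingHom (ZMod k)))
    -- (b) the congruence subgroup C(k) = ker π acts trivially on M
    (hCk : ∀ A : Matrix.symplecticGroup (Fin g) ℤ, π A = 1 → ∀ x : M, A • x = x)
    -- (c) Γ is perfect
    (hperf : commutator (Matrix.symplecticGroup (Fin g) ℤ) = ⊤)
    -- (d) for each prime power p^r exactly dividing k, the kernel of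
    -- Sp(2g,ℤ/p^rℤ) → PSp(2g,ℤ/pℤ) is solvable, and PSp(2g,ℤ/pℤ) is simple non-abelian
    (hd : ∀ (p r : ℕ) (_hp : p.Prime) (hr : 1 ≤ r), p ^ r ∣ k → ¬ p ^ (r + 1) ∣ k →
      ∀ f : Matrix.symplecticGroup (Fin g) (ZMod (p ^ r)) →*
            Matrix.symplecticGroup (Fin g) (ZMod p),
        (∀ A : Matrix.symplecticGroup (Fin g) (ZMod (p ^ r)),
          (f A : Matrix (Fin g ⊕ Fin g) (Fin g ⊕ Fin g) (ZMod p)) =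
            (A : Matrix (Fin g ⊕ Fin g) (Fin g ⊕ Fin g) (ZMod (p ^ r))).map
              (ZMod.castHom (dvd_pow_self p (Nat.one_le_iff_ne_zero.mp hr)) (ZMod p))) →
        IsSolvable ((QuotientGroup.mk'
            (Subgroup.center (Matrix.symplecticGroup (Fin g) (ZMod p)))).comp f).ker ∧
        IsSimpleGroup ((Matrix.symplecticGroup (Fin g) (ZMod p)) ⧸
            Subgroup.center (Matrix.symplecticGroup (Fin g) (ZMod p))) ∧
        ¬ ∀ a b : (Matrix.symplecticGroup (Fin g) (ZMod p)) ⧸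
            Subgroup.center (Matrix.symplecticGroup (Fin g) (ZMod p)), a * b = b * a)
    -- (e) the image of u in PSp(2g,ℤ/pℤ) is nontrivial for each prime p dividing k
    (he : ∀ p : ℕ, p.Prime → p ∣ k →
      ∀ πp : Matrix.symplecticGroup (Fin g) ℤ →* Matrix.symplecticGroup (Fin g) (ZMod p),
        (∀ A : Matrix.symplecticGroup (Fin g) ℤ,
          (πp A : Matrix (Fin g ⊕ Fin g) (Fin g ⊕ Fin g) (ZMod p)) =
            (A : Matrix (Fin g ⊕ Fin g) (Fin g ⊕ Fin g) ℤ).map (Int.castRingHom (ZMod p))) →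
        (QuotientGroup.mk' (Subgroup.center (Matrix.symplecticGroup (Fin g) (ZMod p))))
          (πp u) ≠ 1) :
    ∀ (γ : Matrix.symplecticGroup (Fin g) ℤ) (x : M), γ • x = x := by
  classical
  have : NeZero k := ⟨by omega⟩
  have : Group.IsPerfect (symplecticGroup (Fin g) ℤ) := ⟨hperf⟩
  let N : Subgroup (symplecticGroup (Fin g) ℤ) :=
    (MulAction.toPermHom (symplecticGroup (Fin g) ℤ) M).ker
  have hmemN : ∀ γ, γ ∈ N ↔ ∀ x : M, γ • x = x := fun γ => Equiv.ext_iff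
  suffices hN : N = ⊤ from fun γ => (hmemN γ).1 (hN ▸ Subgroup.mem_top γ)
  have hr (p : k.primeFactors) : k.factorization p ≠ 0 :=
    Finsupp.mem_support_iff.1 (by simp)
  have hprime (p : k.primeFactors) : (p : ℕ).Prime := Nat.prime_of_mem_primeFactors p.2
  let F (p : k.primeFactors) :
      symplecticGroup (Fin g) ℤ →* symplecticGroup (Fin g) (ZMod (p ^ k.factorization p)) :=
    SymplecticGroup.mapHom (Int.castRingHom _)
  let φ (p : k.primeFactors) :
      symplecticGroup (Fin g) (ZMod (p ^ k.factorization p)) →* symplecticGroup (Fin g) (ZMod p) :=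
    SymplecticGroup.mapHom (ZMod.castHom (dvd_pow_self _ (hr p)) (ZMod p))
  let S (p : k.primeFactors) : Subgroup (symplecticGroup (Fin g) (ZMod (p ^ k.factorization p))) :=
    ((QuotientGroup.mk' (Subgroup.center (symplecticGroup (Fin g) (ZMod p)))).comp (φ p)).ker
  have hd' (p : k.primeFactors) := hd p (k.factorization p) (hprime p)
    (Nat.one_le_iff_ne_zero.2 (hr p)) (Nat.ordProj_dvd k p)
    (Nat.pow_succ_factorization_not_dvd (by omega) (hprime p)) (φ p) fun _ => rfl
  have hsolv (p : k.primeFactors) : Group.IsSolvable (S p) := (hd' p).1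
  refine Group.IsPerfect.eq_top_of_sup_comap_eq_top N F S (fun A hA => ?_) fun p => ?_
  · refine (hmemN A).2 (hCk A (Subtype.ext ?_))
    rw [hπ]
    ext i j
    have hdvd : (k : ℤ) ∣ A.1 i j - (1 : Matrix _ _ ℤ) i j := by
      rw [Int.natCast_dvd, Nat.dvd_iff_prime_pow_dvd_dvd]
      intro p r hp hpr
      rcases Nat.eq_zero_or_pos r with rfl | hr0
      · simp
      have hpk : p ∈ k.primeFactors :=
        Nat.mem_primeFactors.2 ⟨hp, (dvd_pow_self p hr0.ne').trans hpr, NeZero.ne k⟩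
      have h := congrFun₂ (congrArg Subtype.val (Subgroup.mem_iInf.1 hA ⟨p, hpk⟩ :
        F ⟨p, hpk⟩ A = 1)) i j
      have h' : ((A.1 i j : ℤ) : ZMod (p ^ k.factorization p)) =
          (((1 : Matrix _ _ ℤ) i j : ℤ) : ZMod (p ^ k.factorization p)) := by
        simpa [F, Matrix.one_apply, apply_ite] using h
      rw [← Int.natCast_dvd]
      refine Int.natCast_dvd_natCast.2 (pow_dvd_pow p
        ((hp.pow_dvd_iff_le_factorization (NeZero.ne k)).1 hpr)) |>.trans ?_
      rw [← ZMod.intCast_zmod_eq_zero_iff_dvd]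
      push_cast
      rw [h', sub_self]
    have h : ((A.1 i j : ℤ) : ZMod k) = (((1 : Matrix _ _ ℤ) i j : ℤ) : ZMod k) := by
      rw [← sub_eq_zero, ← Int.cast_sub]
      exact (ZMod.intCast_zmod_eq_zero_iff_dvd _ k).2 hdvd
    simpa [Matrix.one_apply, apply_ite] using h
  · have : Fact (p : ℕ).Prime := ⟨hprime p⟩
    have := (hd' p).2.1
    let q : symplecticGroup (Fin g) ℤ →*
        symplecticGroup (Fin g) (ZMod p) ⧸ Subgroup.center (symplecticGroup (Fin g) (ZMod p)) :=
      (QuotientGroup.mk' _).comp (SymplecticGroup.mapHom (Int.castRingHom (ZMod p)))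
    have hq : Function.Surjective q := (QuotientGroup.mk'_surjective _).comp
      (SymplecticGroup.mapHom_surjective (ZMod.ringHom_surjective _))
    have hker : (S p).comap (F p) = q.ker := by
      have : (φ p).comp (F p) = SymplecticGroup.mapHom (Int.castRingHom (ZMod p)) := by
        ext A i j
        simp [φ, F]
      rw [MonoidHom.comap_ker, MonoidHom.comp_assoc, this]
    have hmap : N.map q = ⊤ := by
      refine (Subgroup.Normal.eq_bot_or_eq_top (Subgroup.Normal.map inferInstance q hq)).resolve_left
        fun h => ?_
      refine he p (hprime p) (Nat.dvd_of_mem_primeFactors p.2) (SymplecticGroup.mapHom _)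
        (fun _ => rfl) ?_
      exact Subgroup.mem_bot.1 (h ▸ Subgroup.mem_map_of_mem q ((hmemN u).2 huact))
    rw [hker, ← Subgroup.comap_map_eq, hmap, Subgroup.comap_top]
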